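/- For n ∈ ℤ set β_n := (k² − α_n²)^{1/2} (principal complex square root) and γ_n := i(1 + α_n²)^{1/2}, i.e. γ_n is the principal complex square root of −1 − α_n² (the value of β_n for wave number i). Define for each n ∈ ℤ the function d_n : ℝ² → ℂ by d_n(x) := (1/β_n) exp(i α_n x₁ + i β_n |x₂|) − (1/γ_n) exp(i α_n x₁ + i γ_n |x₂|). Then Σ_{n∈ℤ} sup_{x∈ℝ²} |d_n(x)| < ∞; in particular the series Σ_{n∈ℤ} d_n converges absolutely and uniformly on all of ℝ² and defines a continuous function, namely (4π/i) times the difference G_{k,α} − G_{i,α} of the quasi-periodic Green's functions with wave numbers k and i. -/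

import Mathlib

open MeasureTheory

/-- `β_n = (k² − (n+α)²)^{1/2}`, the principal complex square root: positive real when
`k² > (n+α)²`, and `i((n+α)² − k²)^{1/2}` when `k² < (n+α)²`. -/
noncomputable def greenBeta (k α : ℝ) (n : ℤ) : ℂ :=
  if k ^ 2 < ((n : ℝ) + α) ^ 2 then
    Complex.I * (Real.sqrt (((n : ℝ) + α) ^ 2 - k ^ 2) : ℂ)
  else (Real.sqrt (k ^ 2 - ((n : ℝ) + α) ^ 2) : ℂ)

/-- The `n`-th term `(1/β_n) exp(i α_n x₁ + i β_n |x₂|)` of the series for `G_{k,α}`. -/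
noncomputable def greenTerm (k α : ℝ) (n : ℤ) (x : ℝ × ℝ) : ℂ :=
  (1 / greenBeta k α n) *
    Complex.exp (Complex.I * ((((n : ℝ) + α) * x.1 : ℝ) : ℂ) +
      Complex.I * greenBeta k α n * ((|x.2| : ℝ) : ℂ))

/-- The quasi-periodic Green's function `G_{k,α}(x) = (i/(4π)) Σ_{n∈ℤ} greenTerm k α n x`. -/
noncomputable def greenFun (k α : ℝ) (x : ℝ × ℝ) : ℂ :=
  (Complex.I / (4 * (Real.pi : ℂ))) * ∑' n : ℤ, greenTerm k α n x

/-- The orthonormal trigonometric polynomials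
`φ_j(x) = (4πρ)^{−1/2} exp(i((j₁+α)x₁ + (j₂π/ρ)x₂))`. -/
noncomputable def phiFun (α ρ : ℝ) (j : ℤ × ℤ) (x : ℝ × ℝ) : ℂ :=
  (1 / (Real.sqrt (4 * Real.pi * ρ) : ℂ)) *
    Complex.exp (Complex.I *
      (((((j.1 : ℝ) + α) * x.1) + ((j.2 : ℝ) * Real.pi / ρ) * x.2 : ℝ) : ℂ))

/-- `λ_j = k² − (j₁+α)² − (j₂π/ρ)²`. -/
noncomputable def lamFun (k α ρ : ℝ) (j : ℤ × ℤ) : ℝ :=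
  k ^ 2 - ((j.1 : ℝ) + α) ^ 2 - ((j.2 : ℝ) * Real.pi / ρ) ^ 2

/-- The period cell `Ω_ρ = (−π,π) × (−ρ,ρ)`. -/
def OmegaRho (ρ : ℝ) : Set (ℝ × ℝ) := Set.Ioo (-Real.pi) Real.pi ×ˢ Set.Ioo (-ρ) ρ

/-- `γ_n = i(1 + α_n²)^{1/2}`, the principal square root of `−1 − α_n²`, i.e. the value of
`β_n` for wave number `i`. -/
noncomputable def greenGamma (α : ℝ) (n : ℤ) : ℂ :=
  Complex.I * (Real.sqrt (1 + ((n : ℝ) + α) ^ 2) : ℂ)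

/-- The `n`-th term of the series for `G_{i,α}`. -/
noncomputable def greenTermI (α : ℝ) (n : ℤ) (x : ℝ × ℝ) : ℂ :=
  (1 / greenGamma α n) *
    Complex.exp (Complex.I * ((((n : ℝ) + α) * x.1 : ℝ) : ℂ) +
      Complex.I * greenGamma α n * ((|x.2| : ℝ) : ℂ))

/-- The quasi-periodic Green's function with wave number `i`. -/
noncomputable def greenFunI (α : ℝ) (x : ℝ × ℝ) : ℂ :=
  (Complex.I / (4 * (Real.pi : ℂ))) * ∑' n : ℤ, greenTermI α n x

/-- The difference `d_n` of the `n`-th terms of the series for `G_{k,α}` and `G_{i,α}`. -/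
noncomputable def diffTerm (k α : ℝ) (n : ℤ) (x : ℝ × ℝ) : ℂ :=
  greenTerm k α n x - greenTermI α n x

theorem norm_exp_greenTerm_le (a t : ℝ) {z : ℂ} (hz : 0 ≤ z.im) :
    ‖Complex.exp (Complex.I * (a : ℂ) + Complex.I * z * ((|t| : ℝ) : ℂ))‖ ≤ 1 := by
  rw [Complex.norm_exp, Real.exp_le_one_iff]
  have := mul_nonneg hz (abs_nonneg t)
  simpa using this

theorem greenBeta_im_nonneg (k α : ℝ) (n : ℤ) : 0 ≤ (greenBeta k α n).im := by
  unfold greenBeta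
  split_ifs
  · simp
  · simp

theorem greenGamma_im_nonneg (α : ℝ) (n : ℤ) : 0 ≤ (greenGamma α n).im := by
  simp [greenGamma]

theorem bddAbove_norm_diffTerm (k α : ℝ) (n : ℤ) :
    BddAbove (Set.range fun x : ℝ × ℝ => ‖diffTerm k α n x‖) := by
  refine ⟨‖1 / greenBeta k α n‖ + ‖1 / greenGamma α n‖, ?_⟩
  rintro _ ⟨x, rfl⟩
  refine (norm_sub_le _ _).trans (add_le_add ?_ ?_)
  · rw [greenTerm, norm_mul]
    exact mul_le_of_le_one_right (norm_nonneg _)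
      (norm_exp_greenTerm_le _ _ (greenBeta_im_nonneg k α n))
  · rw [greenTermI, norm_mul]
    exact mul_le_of_le_one_right (norm_nonneg _)
      (norm_exp_greenTerm_le _ _ (greenGamma_im_nonneg α n))

theorem continuous_diffTerm (k α : ℝ) (n : ℤ) : Continuous (diffTerm k α n) := by
  unfold diffTerm greenTerm greenTermI
  fun_prop

theorem mul_exp_neg_le_one (y : ℝ) : y * Real.exp (-y) ≤ 1 := by
  have h := Real.add_one_le_exp y
  rw [Real.exp_neg, ← div_eq_mul_inv, div_le_one (Real.exp_pos y)]
  linarith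

/-- For `0 < b ≤ c`, the functions `e^{-bt}/b` and `e^{-ct}/c` are uniformly close on `t ≥ 0`. -/
theorem abs_exp_div_sub_exp_div_le {b c t : ℝ} (hb : 0 < b) (hbc : b ≤ c) (ht : 0 ≤ t) :
    |Real.exp (-(b * t)) / b - Real.exp (-(c * t)) / c| ≤ 2 * (c - b) / (b * c) := by
  have hc : 0 < c := hb.trans_le hbc
  have hexp : Real.exp (-(c * t)) ≤ Real.exp (-(b * t)) := by
    rw [Real.exp_le_exp]
    nlinarith
  have hone : Real.exp (-(b * t)) ≤ 1 := by
    rw [Real.exp_le_one_iff]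
    nlinarith
  have hsplit : Real.exp (-(c * t)) = Real.exp (-(b * t)) * Real.exp (-((c - b) * t)) := by
    rw [← Real.exp_add]
    ring_nf
  have hdiff : b * (Real.exp (-(b * t)) - Real.exp (-(c * t))) ≤ c - b := by
    have h1 := Real.add_one_le_exp (-((c - b) * t))
    have h2 := mul_exp_neg_le_one (b * t)
    have h3 : Real.exp (-(b * t)) - Real.exp (-(c * t))
        ≤ Real.exp (-(b * t)) * ((c - b) * t) := by
      rw [hsplit]
      nlinarith [Real.exp_pos (-(b * t))]
    nlinarith [mul_le_mul_of_nonneg_left h3 hb.le,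
      mul_le_mul_of_nonneg_left h2 (sub_nonneg.2 hbc)]
  have heq : Real.exp (-(b * t)) / b - Real.exp (-(c * t)) / c =
      ((c - b) * Real.exp (-(b * t)) + b * (Real.exp (-(b * t)) - Real.exp (-(c * t))))
        / (b * c) := by
    field_simp
    ring
  have hcb := sub_nonneg.2 hbc
  rw [heq, abs_of_nonneg]
  · gcongr
    nlinarith
  · have := sub_nonneg.2 hexp
    positivity

theorem greenTerm_eq_of_lt {k α : ℝ} {n : ℤ} (h : k ^ 2 < ((n : ℝ) + α) ^ 2) (x : ℝ × ℝ) :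
    greenTerm k α n x = -Complex.I * Complex.exp (Complex.I * ((((n : ℝ) + α) * x.1 : ℝ) : ℂ)) *
      ((Real.exp (-(Real.sqrt (((n : ℝ) + α) ^ 2 - k ^ 2) * |x.2|)) /
        Real.sqrt (((n : ℝ) + α) ^ 2 - k ^ 2) : ℝ) : ℂ) := by
  rw [greenTerm, greenBeta, if_pos h, Complex.exp_add, ← mul_assoc Complex.I Complex.I,
    Complex.I_mul_I, one_div, mul_inv, Complex.inv_I]
  push_cast
  rw [div_eq_mul_inv, neg_one_mul, neg_mul (_ : ℂ) (((|x.2| : ℝ) : ℂ))]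
  ring

theorem greenTermI_eq (α : ℝ) (n : ℤ) (x : ℝ × ℝ) :
    greenTermI α n x = -Complex.I * Complex.exp (Complex.I * ((((n : ℝ) + α) * x.1 : ℝ) : ℂ)) *
      ((Real.exp (-(Real.sqrt (1 + ((n : ℝ) + α) ^ 2) * |x.2|)) /
        Real.sqrt (1 + ((n : ℝ) + α) ^ 2) : ℝ) : ℂ) := by
  rw [greenTermI, greenGamma, Complex.exp_add, ← mul_assoc Complex.I Complex.I,
    Complex.I_mul_I, one_div, mul_inv, Complex.inv_I]
  push_cast
  rw [div_eq_mul_inv, neg_one_mul, neg_mul (_ : ℂ) (((|x.2| : ℝ) : ℂ))]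
  ring

theorem norm_neg_I_mul_exp_mul_ofReal (a r : ℝ) :
    ‖-Complex.I * Complex.exp (Complex.I * (a : ℂ)) * (r : ℂ)‖ = |r| := by
  rw [norm_mul, norm_mul, norm_neg, Complex.norm_I, mul_comm Complex.I,
    Complex.norm_exp_ofReal_mul_I, Complex.norm_real, Real.norm_eq_abs]
  ring

theorem norm_diffTerm_le {k α : ℝ} {n : ℤ} (h : 2 * k ^ 2 + 2 ≤ ((n : ℝ) + α) ^ 2)
    (x : ℝ × ℝ) :
    ‖diffTerm k α n x‖ ≤ 4 * (1 + k ^ 2) * (1 / |(n : ℝ) + α| ^ (2 : ℝ)) := by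
  have hlt : k ^ 2 < ((n : ℝ) + α) ^ 2 := by nlinarith [sq_nonneg k]
  rw [diffTerm, greenTerm_eq_of_lt hlt, greenTermI_eq, ← mul_sub, ← Complex.ofReal_sub,
    norm_neg_I_mul_exp_mul_ofReal, Real.rpow_two, sq_abs]
  set a := ((n : ℝ) + α) ^ 2
  have hk2 := sq_nonneg k
  have hb2 : Real.sqrt (a - k ^ 2) ^ 2 = a - k ^ 2 := Real.sq_sqrt (by linarith)
  have hc2 : Real.sqrt (1 + a) ^ 2 = 1 + a := Real.sq_sqrt (by linarith)
  have hb1 : 1 ≤ Real.sqrt (a - k ^ 2) := Real.one_le_sqrt.2 (by linarith)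
  have hbc : Real.sqrt (a - k ^ 2) ≤ Real.sqrt (1 + a) := Real.sqrt_le_sqrt (by linarith)
  refine (abs_exp_div_sub_exp_div_le (by linarith) hbc (abs_nonneg _)).trans ?_
  set b := Real.sqrt (a - k ^ 2)
  set c := Real.sqrt (1 + a)
  have ha : 0 < a := by linarith
  have hprod : a ≤ 2 * (b * c) := by nlinarith
  have hdiff : c - b ≤ 1 + k ^ 2 := by nlinarith
  rw [mul_one_div, div_le_div_iff₀ (by nlinarith) ha]
  nlinarith [mul_le_mul hdiff hprod ha.le (by positivity)]

theorem norm_greenTerm_le {k α : ℝ} {n : ℤ} (h : 2 * k ^ 2 + 2 ≤ ((n : ℝ) + α) ^ 2)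
    {x : ℝ × ℝ} (hx : x.2 ≠ 0) :
    ‖greenTerm k α n x‖ ≤ 2 / |x.2| * (1 / |(n : ℝ) + α| ^ (2 : ℝ)) := by
  have hlt : k ^ 2 < ((n : ℝ) + α) ^ 2 := by nlinarith [sq_nonneg k]
  rw [greenTerm_eq_of_lt hlt, norm_neg_I_mul_exp_mul_ofReal, Real.rpow_two, sq_abs]
  set a := ((n : ℝ) + α) ^ 2
  have hk2 := sq_nonneg k
  have hb2 : Real.sqrt (a - k ^ 2) ^ 2 = a - k ^ 2 := Real.sq_sqrt (by linarith)
  have hb : 0 < Real.sqrt (a - k ^ 2) := Real.sqrt_pos.2 (by linarith)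
  set b := Real.sqrt (a - k ^ 2)
  have ha : 0 < a := by linarith
  have ht : 0 < |x.2| := abs_pos.2 hx
  have hexp := mul_exp_neg_le_one (b * |x.2|)
  have hE := Real.exp_pos (-(b * |x.2|))
  rw [abs_of_pos (by positivity), div_mul_div_comm, mul_one, div_le_div_iff₀ hb (by positivity)]
  set E := Real.exp (-(b * |x.2|))
  have hab : a ≤ 2 * b ^ 2 := by linarith
  calc E * (|x.2| * a) ≤ E * (|x.2| * (2 * b ^ 2)) := by gcongr
    _ = 2 * b * (b * |x.2| * E) := by ring
    _ ≤ 2 * b * 1 := by gcongr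
    _ = 2 * b := mul_one _

theorem eventually_le_int_add_sq (α C : ℝ) :
    ∀ᶠ n : ℤ in Filter.cofinite, C ≤ ((n : ℝ) + α) ^ 2 := by
  have h := tendsto_norm_cocompact_atTop.comp Int.tendsto_coe_cofinite
  filter_upwards [h.eventually_ge_atTop (|α| + |C| + 1)] with n hn
  have hn' : |α| + |C| + 1 ≤ |(n : ℝ)| := hn
  have h1 : |C| + 1 ≤ |(n : ℝ) + α| := by
    have := abs_sub_abs_le_abs_sub (n : ℝ) (-α)
    rw [abs_neg, sub_neg_eq_add] at this
    linarith
  rw [← sq_abs]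
  nlinarith [le_abs_self C, abs_nonneg C]

theorem summable_iSup_norm_diffTerm (k α : ℝ) :
    Summable fun n : ℤ => ⨆ x : ℝ × ℝ, ‖diffTerm k α n x‖ := by
  refine Summable.of_norm_bounded_eventually
    (((Real.summable_one_div_int_add_rpow α 2).2 one_lt_two).mul_left (4 * (1 + k ^ 2))) ?_
  filter_upwards [eventually_le_int_add_sq α (2 * k ^ 2 + 2)] with n hn
  rw [Real.norm_of_nonneg (Real.iSup_nonneg fun _ => norm_nonneg _)]
  exact ciSup_le (norm_diffTerm_le hn)

theorem summable_greenTerm (k α : ℝ) {x : ℝ × ℝ} (hx : x.2 ≠ 0) :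
    Summable fun n : ℤ => greenTerm k α n x := by
  refine Summable.of_norm_bounded_eventually
    (((Real.summable_one_div_int_add_rpow α 2).2 one_lt_two).mul_left (2 / |x.2|)) ?_
  filter_upwards [eventually_le_int_add_sq α (2 * k ^ 2 + 2)] with n hn
  exact norm_greenTerm_le hn hx

/-- The suprema over `ℝ²` of the differences `d_n` are summable; hence
`Σ_n d_n` converges absolutely and uniformly on `ℝ²` and defines a continuous function, which
for `x₂ ≠ 0` equals `(4π/i)(G_{k,α} − G_{i,α})`. -/
theorem diff_green_series_uniform
    (k α : ℝ) (hk : 0 < k)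
    (hres : ∀ n : ℤ, k ^ 2 ≠ ((n : ℝ) + α) ^ 2) :
    Summable (fun n : ℤ => ⨆ x : ℝ × ℝ, ‖diffTerm k α n x‖) ∧
    TendstoUniformlyOn
      (fun (s : Finset ℤ) (x : ℝ × ℝ) => ∑ n ∈ s, diffTerm k α n x)
      (fun x => ∑' n : ℤ, diffTerm k α n x) Filter.atTop Set.univ ∧
    Continuous (fun x : ℝ × ℝ => ∑' n : ℤ, diffTerm k α n x) ∧
    ∀ x : ℝ × ℝ, x.2 ≠ 0 →
      ∑' n : ℤ, diffTerm k α n x =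
        (4 * (Real.pi : ℂ) / Complex.I) * (greenFun k α x - greenFunI α x) := by
  have hsum := summable_iSup_norm_diffTerm k α
  have hle : ∀ (n : ℤ) (x : ℝ × ℝ), ‖diffTerm k α n x‖ ≤ ⨆ x : ℝ × ℝ, ‖diffTerm k α n x‖ :=
    fun n x => le_ciSup (bddAbove_norm_diffTerm k α n) x
  refine ⟨hsum, tendstoUniformlyOn_tsum hsum fun n x _ => hle n x,
    continuous_tsum (continuous_diffTerm k α) hsum hle, fun x hx => ?_⟩
  have hd : Summable fun n : ℤ => diffTerm k α n x :=
    Summable.of_norm_bounded hsum fun n => hle n x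
  have hg := summable_greenTerm k α hx
  have hgI : Summable fun n : ℤ => greenTermI α n x := by
    simpa [diffTerm] using hg.sub hd
  have hpi : (Real.pi : ℂ) ≠ 0 := Complex.ofReal_ne_zero.2 Real.pi_ne_zero
  rw [greenFun, greenFunI, ← mul_sub, ← hg.tsum_sub hgI, ← mul_assoc]
  have hcancel : 4 * (Real.pi : ℂ) / Complex.I * (Complex.I / (4 * (Real.pi : ℂ))) = 1 := by
    field_simp [Complex.I_ne_zero]
  rw [hcancel, one_mul]
  rfl
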